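/- arXiv:2402.09489 — 10 statements merged into one kernel-verified Lean document; each statement's English description precedes it below -/
import Mathlib

section
/- Let n ≥ 1, let W be a real symmetric n×n matrix that is positive definite on span(1)^⊥, and let x, y : Fin n → ℝ be non-constant vectors. Then the network Pearson correlation ρ_{x,y,W} = (Σ_{i,j} W_ij · x̂_i · ŷ_j) / √((Σ_{i,j} W_ij · x̂_i · x̂_j) · (Σ_{i,j} W_ij · ŷ_i · ŷ_j)) satisfies −1 ≤ ρ_{x,y,W} ≤ 1. -/
/-- Cauchy–Schwarz for a symmetric matrix that is positive semidefinite on the vectors of sum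
zero. -/
theorem Matrix.IsSymm.sq_sum_le_of_nonneg_of_sum_eq_zero {ι : Type*} [Fintype ι]
    {W : Matrix ι ι ℝ} (hsymm : W.IsSymm)
    (hW : ∀ v : ι → ℝ, ∑ i, v i = 0 → 0 ≤ ∑ i, ∑ j, W i j * v i * v j)
    {u v : ι → ℝ} (hu : ∑ i, u i = 0) (hv : ∑ i, v i = 0) :
    (∑ i, ∑ j, W i j * u i * v j) ^ 2 ≤
      (∑ i, ∑ j, W i j * u i * u j) * (∑ i, ∑ j, W i j * v i * v j) := by
  have hcomm : ∑ i, ∑ j, W i j * v i * u j = ∑ i, ∑ j, W i j * u i * v j := by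
    rw [Finset.sum_comm]
    refine Finset.sum_congr rfl fun i _ => Finset.sum_congr rfl fun j _ => ?_
    rw [hsymm.apply i j]
    ring
  have hquad (t : ℝ) : 0 ≤ (∑ i, ∑ j, W i j * v i * v j) * (t * t) +
      (2 * ∑ i, ∑ j, W i j * u i * v j) * t + ∑ i, ∑ j, W i j * u i * u j := by
    have hsum : ∑ i, (u i + t * v i) = 0 := by
      rw [Finset.sum_add_distrib, ← Finset.mul_sum, hu, hv, mul_zero, add_zero]
    refine (hW _ hsum).trans_eq ?_
    rw [two_mul]
    nth_rw 2 [← hcomm]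
    simp only [add_mul, Finset.sum_mul, ← Finset.sum_add_distrib]
    refine Finset.sum_congr rfl fun i _ => Finset.sum_congr rfl fun j _ => ?_
    ring
  have hdiscrim := discrim_le_zero hquad
  rw [discrim] at hdiscrim
  linarith

theorem sum_sub_sum_div_eq_zero {n : ℕ} (hn : 1 ≤ n) (x : Fin n → ℝ) :
    ∑ i, (x i - (∑ k, x k) / n) = 0 := by
  have hn' : (n : ℝ) ≠ 0 := by positivity
  simp [Finset.sum_sub_distrib, mul_div_cancel₀ _ hn']

theorem stmt_2 (n : ℕ) (hn : 1 ≤ n) (W : Matrix (Fin n) (Fin n) ℝ)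
    (hsymm : W.IsSymm)
    (hpd : ∀ v : Fin n → ℝ, v ≠ 0 → ∑ i, v i = 0 →
      0 < ∑ i, ∑ j, W i j * v i * v j)
    (x y : Fin n → ℝ)
    (hx : (fun i => x i - (∑ k, x k) / n) ≠ 0)
    (hy : (fun i => y i - (∑ k, y k) / n) ≠ 0)
    (ρ : ℝ)
    (hρ : ρ = (∑ i, ∑ j, W i j * (x i - (∑ k, x k) / n) * (y j - (∑ k, y k) / n)) /
      Real.sqrt ((∑ i, ∑ j, W i j * (x i - (∑ k, x k) / n) * (x j - (∑ k, x k) / n)) *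
        (∑ i, ∑ j, W i j * (y i - (∑ k, y k) / n) * (y j - (∑ k, y k) / n)))) :
    -1 ≤ ρ ∧ ρ ≤ 1 := by
  have hx0 := sum_sub_sum_div_eq_zero hn x
  have hy0 := sum_sub_sum_div_eq_zero hn y
  have hnonneg : ∀ v : Fin n → ℝ, ∑ i, v i = 0 → 0 ≤ ∑ i, ∑ j, W i j * v i * v j := by
    intro v hv
    rcases eq_or_ne v 0 with rfl | hv0
    · simp
    · exact (hpd v hv0 hv).le
  have hpos := Real.sqrt_pos.2 (mul_pos (hpd _ hx hx0) (hpd _ hy hy0))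
  have hle := Real.abs_le_sqrt (hsymm.sq_sum_le_of_nonneg_of_sum_eq_zero hnonneg hx0 hy0)
  rw [← abs_le, hρ, abs_div, abs_of_pos hpos]
  exact (div_le_one hpos).2 hle
end

section
/- Let n ≥ 1, let W be a real symmetric n×n matrix, and let Ŵ be its double-centered matrix, Ŵ_ij = W_ij − (1/n)·Σ_k (W_ik + W_kj) + (1/n²)·Σ_{k,l} W_kl. Then W is positive definite on span(1)^⊥ if and only if Ŵ is positive semidefinite and the kernel of Ŵ is exactly the span of the all-ones vector. -/
namespace Matrix

variable {ι : Type*} [Fintype ι]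

theorem dotProduct_mulVec_eq_sum_sum (M : Matrix ι ι ℝ) (v : ι → ℝ) :
    v ⬝ᵥ M *ᵥ v = ∑ i, ∑ j, M i j * v i * v j := by
  simp only [dotProduct, mulVec, Finset.mul_sum]
  exact Finset.sum_congr rfl fun i _ => Finset.sum_congr rfl fun j _ => by ring

theorem IsSymm.dotProduct_mulVec_add_of_mulVec_eq_zero {M : Matrix ι ι ℝ} (hM : M.IsSymm)
    {w : ι → ℝ} (hw : M *ᵥ w = 0) (u : ι → ℝ) :
    (u + w) ⬝ᵥ M *ᵥ (u + w) = u ⬝ᵥ M *ᵥ u := by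
  have hw' : w ᵥ* M = 0 := by rw [← mulVec_transpose, hM.eq, hw]
  rw [mulVec_add, hw, add_zero, add_dotProduct, dotProduct_mulVec w, hw', zero_dotProduct,
    add_zero]

end Matrix

open Matrix in
theorem stmt_5 (n : ℕ) (hn : 1 ≤ n) (W : Matrix (Fin n) (Fin n) ℝ)
    (hsymm : W.IsSymm)
    (What : Matrix (Fin n) (Fin n) ℝ)
    (hWhat : ∀ i j, What i j =
      W i j - (∑ k, (W i k + W k j)) / n + (∑ k, ∑ l, W k l) / (n : ℝ) ^ 2) :
    (∀ v : Fin n → ℝ, v ≠ 0 → ∑ i, v i = 0 →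
      0 < ∑ i, ∑ j, W i j * v i * v j) ↔
    ((∀ v : Fin n → ℝ, 0 ≤ ∑ i, ∑ j, What i j * v i * v j) ∧
      (∀ v : Fin n → ℝ, What.mulVec v = 0 ↔ ∃ c : ℝ, v = fun _ => c)) := by
  have hn0 : (n : ℝ) ≠ 0 := by positivity
  have hsymm' : What.IsSymm := by
    ext i j
    simp only [transpose_apply, hWhat, hsymm.apply i j, Finset.sum_add_distrib,
      hsymm.apply i, fun k => hsymm.apply k j]
    ring
  have hconst : ∀ c : ℝ, What *ᵥ (fun _ => c) = 0 := by
    intro c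
    ext i
    simp only [mulVec, dotProduct, ← Finset.sum_mul, hWhat, Finset.sum_add_distrib,
      Finset.sum_sub_distrib, ← Finset.sum_div, Finset.sum_const, Finset.card_univ,
      Fintype.card_fin, nsmul_eq_mul, Pi.zero_apply]
    rw [Finset.sum_comm (f := fun x k => W k x)]
    field_simp
    ring
  have hquad : ∀ v : Fin n → ℝ, ∑ i, v i = 0 → v ⬝ᵥ What *ᵥ v = v ⬝ᵥ W *ᵥ v := by
    intro v hv
    have hmul : ∀ i, (What *ᵥ v) i = (W *ᵥ v) i - ∑ j, (∑ k, W k j) / n * v j := by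
      intro i
      simp only [mulVec, dotProduct, hWhat, Finset.sum_add_distrib, add_mul, sub_mul, add_div,
        Finset.sum_sub_distrib, ← Finset.mul_sum, hv]
      ring
    simp only [dotProduct, hmul, mul_sub, Finset.sum_sub_distrib, ← Finset.sum_mul, hv, zero_mul,
      sub_zero]
  have hdecomp : ∀ v : Fin n → ℝ, ∃ (u : Fin n → ℝ) (c : ℝ), ∑ i, u i = 0 ∧
      v = u + fun _ => c := by
    intro v
    refine ⟨fun i => v i - (∑ k, v k) / n, (∑ k, v k) / n, ?_, ?_⟩
    · simp only [Finset.sum_sub_distrib, Finset.sum_const, Finset.card_univ, Fintype.card_fin,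
        nsmul_eq_mul]
      field_simp
      ring
    · ext i
      simp
  simp only [← dotProduct_mulVec_eq_sum_sum]
  constructor
  · intro h
    refine ⟨fun v => ?_, fun v => ⟨fun hv => ?_, ?_⟩⟩
    · obtain ⟨u, c, hu, rfl⟩ := hdecomp v
      rw [hsymm'.dotProduct_mulVec_add_of_mulVec_eq_zero (hconst c), hquad u hu]
      rcases eq_or_ne u 0 with rfl | hu0
      · simp
      · exact (h u hu0 hu).le
    · obtain ⟨u, c, hu, rfl⟩ := hdecomp v
      rw [mulVec_add, hconst, add_zero] at hv
      have hu0 : u = 0 := by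
        by_contra hu0
        have hpos := h u hu0 hu
        rw [← hquad u hu, hv, dotProduct_zero] at hpos
        exact hpos.false
      exact ⟨c, by rw [hu0, zero_add]⟩
    · rintro ⟨c, rfl⟩
      exact hconst c
  · rintro ⟨hnonneg, hker⟩ v hv0 hv
    rw [← hquad v hv]
    refine (hnonneg v).lt_of_ne' fun hzero => hv0 ?_
    have hpsd : What.PosSemidef := PosSemidef.of_dotProduct_mulVec_nonneg
      (isHermitian_iff_isSymm.mpr hsymm') (by simpa using hnonneg)
    obtain ⟨c, rfl⟩ := (hker v).mp ((hpsd.dotProduct_mulVec_zero_iff v).mp (by simpa using hzero))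
    have hc : c = 0 := by simpa [hn0] using hv
    ext
    simp [hc]
end

section
/- (Schoenberg) Let n ≥ 1 and let D be a real symmetric n×n matrix with D_ii = 0 for all i, D_ij > 0 for i ≠ j, satisfying the triangle inequality D_ij ≤ D_ik + D_kj for all i, j, k, and of negative type. Then for every real k > 0, the matrix W with entries W_ij = exp(−k·D_ij) is positive definite. -/
theorem Matrix.PosSemidef.map_pow {ι : Type*} [Finite ι] {A : Matrix ι ι ℝ}
    (hA : A.PosSemidef) (m : ℕ) : (A.map (· ^ m)).PosSemidef := by
  induction m with
  | zero =>
    have h := Matrix.posSemidef_vecMulVec_self_star (fun _ : ι => (1 : ℝ))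
    convert h using 1
    ext i j
    simp [Matrix.vecMulVec_apply]
  | succ m ih =>
    have h : A.map (· ^ (m + 1)) = (A.map (· ^ m)).hadamard A := by
      ext i j
      simp [pow_succ]
    rw [h]
    exact ih.hadamard hA

/-- The Gram matrix, based at `o`, of a matrix of negative type. -/
theorem posSemidef_of_negative_type {ι : Type*} [Fintype ι] [DecidableEq ι]
    {D : Matrix ι ι ℝ} (hsymm : D.IsSymm) (hdiag : ∀ i, D i i = 0)
    (hneg : ∀ v : ι → ℝ, ∑ i, v i = 0 → ∑ i, ∑ j, D i j * v i * v j ≤ 0) (o : ι) :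
    (Matrix.of fun i j => D i o + D j o - D i j).PosSemidef := by
  refine Matrix.PosSemidef.of_dotProduct_mulVec_nonneg ?_ fun w => ?_
  · ext i j
    simp [hsymm.apply i j, add_comm]
  · have hs : ∀ i j, D i j = D j i := fun i j => hsymm.apply j i
    have h := hneg (fun i => w i - (∑ l, w l) * if i = o then 1 else 0) (by simp)
    have h1 : ∑ i, ∑ j, D i j * (w i - (∑ l, w l) * if i = o then 1 else 0) *
        (w j - (∑ l, w l) * if j = o then 1 else 0) =
        ∑ i, ∑ j, D i j * w i * w j - 2 * ((∑ l, w l) * ∑ i, D i o * w i) := by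
      simp only [mul_sub, sub_mul, Finset.sum_sub_distrib, mul_ite, ite_mul, mul_one, mul_zero,
        zero_mul, Finset.sum_ite_eq', Finset.mem_univ, if_true, Finset.sum_ite_irrel,
        Finset.sum_const_zero, hdiag]
      simp only [hs o, ← Finset.sum_mul, mul_right_comm _ (∑ l, w l)]
      ring
    have h2 : dotProduct (star w) ((Matrix.of fun i j => D i o + D j o - D i j).mulVec w) =
        2 * ((∑ l, w l) * ∑ i, D i o * w i) - ∑ i, ∑ j, D i j * w i * w j := by
      have e1 : ∑ i, ∑ j, D i o * w i * w j = (∑ l, w l) * ∑ i, D i o * w i := by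
        rw [mul_comm, Finset.sum_mul_sum]
      have e2 : ∑ i, ∑ j, D j o * w i * w j = (∑ l, w l) * ∑ i, D i o * w i := by
        rw [Finset.sum_mul_sum]
        exact Finset.sum_congr rfl fun i _ => Finset.sum_congr rfl fun j _ => by ring
      rw [two_mul]
      nth_rewrite 1 [← e1]
      rw [← e2]
      simp only [dotProduct, Matrix.mulVec, Matrix.of_apply, star_trivial, Finset.mul_sum,
        ← Finset.sum_add_distrib, ← Finset.sum_sub_distrib]
      exact Finset.sum_congr rfl fun i _ => Finset.sum_congr rfl fun j _ => by ring
    rw [h2]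
    linarith

theorem sum_mul_mul_eq_dotProduct_mulVec {ι : Type*} [Fintype ι] (A : Matrix ι ι ℝ)
    (u : ι → ℝ) : ∑ i, ∑ j, A i j * u i * u j = dotProduct (star u) (A.mulVec u) := by
  simp only [dotProduct, Matrix.mulVec, star_trivial, Finset.mul_sum]
  exact Finset.sum_congr rfl fun i _ => Finset.sum_congr rfl fun j _ => by ring

/-- The entrywise exponential of the Gram matrix of pairwise distinct vectors is positive
definite. -/
theorem sum_exp_mul_mul_pos {ι : Type*} [Fintype ι] {A : Matrix ι ι ℝ}
    (hA : A.PosSemidef) (hlt : ∀ i j, i ≠ j → 2 * A i j < A i i + A j j)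
    {u : ι → ℝ} (hu : u ≠ 0) : 0 < ∑ i, ∑ j, Real.exp (A i j) * u i * u j := by
  classical
  have hnonneg (m : ℕ) : 0 ≤ ∑ i, ∑ j, A i j ^ m / m.factorial * u i * u j := by
    have h := (hA.map_pow m).dotProduct_mulVec_nonneg u
    rw [← sum_mul_mul_eq_dotProduct_mulVec] at h
    have h' := div_nonneg h (Nat.cast_nonneg (α := ℝ) m.factorial)
    simp only [Finset.sum_div, Matrix.map_apply] at h'
    refine h'.trans_eq <| Finset.sum_congr rfl fun i _ => Finset.sum_congr rfl fun j _ => by ring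
  have hsum : HasSum (fun m : ℕ => ∑ i, ∑ j, A i j ^ m / m.factorial * u i * u j)
      (∑ i, ∑ j, Real.exp (A i j) * u i * u j) := by
    refine hasSum_sum fun i _ => hasSum_sum fun j _ => ?_
    have h := NormedSpace.expSeries_div_hasSum_exp (A i j)
    rw [← Real.exp_eq_exp_ℝ] at h
    exact (h.mul_right _).mul_right _
  refine (hsum.nonneg hnonneg).lt_of_ne fun h0 => hu ?_
  rw [← h0] at hsum
  have hzero := (hasSum_zero_iff_of_nonneg hnonneg).1 hsum
  have hker (m : ℕ) (i : ι) : ∑ j, A i j ^ m * u j = 0 := by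
    have h : dotProduct (star u) ((A.map (· ^ m)).mulVec u) = 0 := by
      rw [← sum_mul_mul_eq_dotProduct_mulVec]
      have h' := congrArg (· * (m.factorial : ℝ)) (congrFun hzero m)
      simp only [Finset.sum_mul, Pi.zero_apply, zero_mul] at h'
      rw [← h']
      refine Finset.sum_congr rfl fun i _ => Finset.sum_congr rfl fun j _ => ?_
      simp only [Matrix.map_apply]
      field_simp
    exact congrFun (((hA.map_pow m).dotProduct_mulVec_zero_iff u).1 h) i
  have hpoly (p : Polynomial ℝ) (i : ι) : ∑ j, p.eval (A i j) * u j = 0 := by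
    simp only [Polynomial.eval_eq_sum_range, Finset.sum_mul]
    rw [Finset.sum_comm]
    refine Finset.sum_eq_zero fun m _ => ?_
    simp only [mul_assoc, ← Finset.mul_sum, hker, mul_zero]
  by_contra hne
  obtain ⟨a, ha⟩ := Function.ne_iff.1 hne
  obtain ⟨i, hi, hmax⟩ := (Finset.univ.filter fun j => u j ≠ 0).exists_max_image
    (fun j => A j j) ⟨a, by simpa using ha⟩
  simp only [Finset.mem_filter, Finset.mem_univ, true_and] at hi hmax
  have h := hpoly (∏ j with u j ≠ 0 ∧ j ≠ i, (Polynomial.X - Polynomial.C (A i j))) i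
  rw [Finset.sum_eq_single i] at h
  · rcases mul_eq_zero.1 h with h | h
    · rw [Polynomial.eval_prod, Finset.prod_eq_zero_iff] at h
      obtain ⟨j, hj, hji⟩ := h
      simp only [Finset.mem_filter, Finset.mem_univ, true_and] at hj
      simp only [Polynomial.eval_sub, Polynomial.eval_X, Polynomial.eval_C] at hji
      linarith [hmax j hj.1, hlt i j hj.2.symm]
    · exact hi h
  · intro j _ hj
    by_cases huj : u j = 0
    · rw [huj, mul_zero]
    · rw [Polynomial.eval_prod, Finset.prod_eq_zero (i := j) (by simp [huj, hj]) (by simp),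
        zero_mul]
  · simp

theorem stmt_6 (n : ℕ) (hn : 1 ≤ n) (D : Matrix (Fin n) (Fin n) ℝ)
    (hsymm : D.IsSymm)
    (hdiag : ∀ i, D i i = 0)
    (hpos : ∀ i j, i ≠ j → 0 < D i j)
    (htri : ∀ i j k, D i j ≤ D i k + D k j)
    (hneg : ∀ v : Fin n → ℝ, ∑ i, v i = 0 →
      ∑ i, ∑ j, D i j * v i * v j ≤ 0)
    (k : ℝ) (hk : 0 < k) :
    ∀ v : Fin n → ℝ, v ≠ 0 →
      0 < ∑ i, ∑ j, Real.exp (-k * D i j) * v i * v j := by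
  intro v hv
  let o : Fin n := ⟨0, hn⟩
  have hA := (posSemidef_of_negative_type hsymm hdiag hneg o).smul hk.le
  have hu : (fun i => Real.exp (-k * D i o) * v i) ≠ 0 := by
    obtain ⟨a, ha⟩ := Function.ne_iff.1 hv
    exact Function.ne_iff.2 ⟨a, mul_ne_zero (Real.exp_ne_zero _) ha⟩
  refine (sum_exp_mul_mul_pos hA (fun i j hij => ?_) hu).trans_eq ?_
  · simp only [Matrix.smul_apply, Matrix.of_apply, smul_eq_mul, hdiag]
    linarith [mul_pos hk (hpos i j hij)]
  · refine Finset.sum_congr rfl fun i _ => Finset.sum_congr rfl fun j _ => ?_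
    have h : -k * D i j = k * (D i o + D j o - D i j) + -k * D i o + -k * D j o := by ring
    rw [h, Real.exp_add, Real.exp_add]
    simp only [Matrix.smul_apply, Matrix.of_apply, smul_eq_mul]
    ring
end

section
/- Let n ≥ 1 and let D be a real symmetric n×n matrix with zero diagonal. If for every real k > 0 the matrix with entries exp(−k·D_ij) is positive semidefinite, then D is of negative type, i.e., for every v : Fin n → ℝ with Σ_i v_i = 0 one has Σ_{i,j} D_ij · v_i · v_j ≤ 0. -/
/-- A function that vanishes at `a` and is nonnegative to the right of `a` has nonnegative
derivative at `a`. -/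
theorem HasDerivAt.nonneg_of_nonneg_right {f : ℝ → ℝ} {f' a : ℝ} (hf : HasDerivAt f f' a)
    (ha : f a = 0) (hpos : ∀ x, a < x → 0 ≤ f x) : 0 ≤ f' := by
  have hslope := (hasDerivAt_iff_tendsto_slope.mp hf).mono_left
    (nhdsWithin_mono a (s := Set.Ioi a) fun x hx => ne_of_gt hx)
  refine ge_of_tendsto hslope ?_
  filter_upwards [self_mem_nhdsWithin] with x (hx : a < x)
  rw [slope_def_field, ha, sub_zero]
  exact div_nonneg (hpos x hx) (sub_nonneg.mpr hx.le)

/-- The derivative at `0` of the quadratic form of the entrywise exponential of `-k • D`. -/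
theorem hasDerivAt_sum_exp_neg_mul {ι : Type*} [Fintype ι] (D : Matrix ι ι ℝ) (v : ι → ℝ) :
    HasDerivAt (fun k : ℝ => ∑ i, ∑ j, Real.exp (-k * D i j) * v i * v j)
      (-∑ i, ∑ j, D i j * v i * v j) 0 := by
  simp only [← Finset.sum_neg_distrib]
  refine HasDerivAt.fun_sum fun i _ => HasDerivAt.fun_sum fun j _ => ?_
  have h := (((hasDerivAt_neg (0 : ℝ)).mul_const (D i j)).exp.mul_const (v i)).mul_const (v j)
  simpa using h

theorem stmt_7 (n : ℕ) (hn : 1 ≤ n) (D : Matrix (Fin n) (Fin n) ℝ)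
    (hsymm : D.IsSymm)
    (hdiag : ∀ i, D i i = 0)
    (hpsd : ∀ k : ℝ, 0 < k → ∀ v : Fin n → ℝ,
      0 ≤ ∑ i, ∑ j, Real.exp (-k * D i j) * v i * v j) :
    ∀ v : Fin n → ℝ, ∑ i, v i = 0 →
      ∑ i, ∑ j, D i j * v i * v j ≤ 0 := by
  intro v hv
  refine neg_nonneg.mp ((hasDerivAt_sum_exp_neg_mul D v).nonneg_of_nonneg_right ?_
    fun k hk => hpsd k hk v)
  simp [← Finset.mul_sum, hv]
end

section
/- (Schoenberg) Let n, d ≥ 1 and let u_1, …, u_n be points in the Euclidean space ℝ^d. Define the n×n matrix D by D_ij = ‖u_i − u_j‖ (Euclidean distance). Then D is of negative type: for every v : Fin n → ℝ with Σ_i v_i = 0 one has Σ_{i,j} D_ij · v_i · v_j ≤ 0. -/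
open MeasureTheory ProbabilityTheory in
/-- The absolute value on `ℝ` defines a distance of negative type. -/
theorem sum_abs_sub_mul_mul_nonpos {ι : Type*} [Fintype ι] (a v : ι → ℝ)
    (hv : ∑ i, v i = 0) : ∑ i, ∑ j, |a i - a j| * v i * v j ≤ 0 := by
  obtain ⟨m, hm⟩ : ∃ m, ∀ i, m ≤ a i := by
    obtain ⟨m, hm⟩ := (Set.finite_range a).bddBelow
    exact ⟨m, fun i => hm ⟨i, rfl⟩⟩
  have hpos : (Matrix.of fun i j : ι =>
      (volume : Measure ℝ).real (Set.Ioc m (a i) ∩ Set.Ioc m (a j))).PosSemidef :=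
    posSemidef_matrix_measure_inter (fun _ => measurableSet_Ioc) (fun j => by simp)
  have hmin := hpos.dotProduct_mulVec_nonneg v
  have habs : ∀ i j, |a i - a j| * v i * v j =
      (a i - m) * v i * v j + (a j - m) * v j * v i -
        2 * (v i * ((volume : Measure ℝ).real (Set.Ioc m (a i) ∩ Set.Ioc m (a j)) * v j)) := by
    intro i j
    rw [Set.Ioc_inter_Ioc, Real.volume_real_Ioc_of_le (by simp [hm]), max_self]
    change _ = _ - 2 * (v i * ((min (a i) (a j) - m) * v j))
    rcases le_total (a i) (a j) with h | h
    · rw [min_eq_left h, abs_of_nonpos (by linarith)]; ring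
    · rw [min_eq_right h, abs_of_nonneg (by linarith)]; ring
  have h1 : ∑ i, ∑ j, (a i - m) * v i * v j = 0 := by
    simp [← Finset.mul_sum, hv]
  have h2 : ∑ i, ∑ j, (a j - m) * v j * v i = 0 := by
    rw [Finset.sum_comm]; exact h1
  simp only [habs, Finset.sum_sub_distrib, Finset.sum_add_distrib, h2, ← Finset.mul_sum, hv, mul_zero,
    Finset.sum_const_zero]
  simp only [dotProduct, Matrix.mulVec, Matrix.of_apply, star_trivial] at hmin
  linarith

section Gaussian

open MeasureTheory ProbabilityTheory

variable {E : Type*} [NormedAddCommGroup E] [InnerProductSpace ℝ E] [FiniteDimensional ℝ E]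
  [MeasurableSpace E] [BorelSpace E]

theorem integrable_abs_inner_stdGaussian (x : E) :
    Integrable (fun θ => |inner ℝ x θ|) (stdGaussian E) :=
  ((innerSL ℝ x).integrable_comp IsGaussian.integrable_id).abs

theorem integral_abs_inner_stdGaussian (x : E) :
    ∫ θ, |inner ℝ x θ| ∂stdGaussian E = ‖x‖ * ∫ t, |t| ∂gaussianReal 0 1 := by
  have hmap : (stdGaussian E).map (innerSL ℝ x) = (gaussianReal 0 1).map (‖x‖ * ·) := by
    rw [IsGaussian.map_eq_gaussianReal, integral_strongDual_stdGaussian,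
      variance_dual_stdGaussian, gaussianReal_map_const_mul, innerSL_apply_norm]
    congr 1
    · simp
    · ext; simp
  calc ∫ θ, |inner ℝ x θ| ∂stdGaussian E
      = ∫ t, |t| ∂(stdGaussian E).map (innerSL ℝ x) := by
        rw [integral_map (by fun_prop) (by fun_prop)]; rfl
    _ = ‖x‖ * ∫ t, |t| ∂gaussianReal 0 1 := by
        rw [hmap, integral_map (by fun_prop) (by fun_prop), ← integral_const_mul]
        simp [abs_mul]

theorem integral_abs_gaussianReal_pos : 0 < ∫ t, |t| ∂gaussianReal 0 1 := by
  have : NullSingletonClass (gaussianReal 0 1) := nullSingletonClass_gaussianReal one_ne_zero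
  have hint : Integrable (fun t : ℝ => |t|) (gaussianReal 0 1) :=
    (IsGaussian.integrable_id (μ := gaussianReal 0 1)).abs
  rw [integral_pos_iff_support_of_nonneg (fun t => abs_nonneg t) hint]
  have hsupp : Function.support (fun t : ℝ => |t|) = {0}ᶜ := by ext; simp
  rw [hsupp, prob_compl_eq_one_sub (measurableSet_singleton 0), measure_singleton]
  simp

end Gaussian

open MeasureTheory ProbabilityTheory in
/-- The distance of a Euclidean space is of negative type. -/
theorem sum_norm_sub_mul_mul_nonpos {E : Type*} [NormedAddCommGroup E] [InnerProductSpace ℝ E]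
    [FiniteDimensional ℝ E] {ι : Type*} [Fintype ι] (u : ι → E) (v : ι → ℝ)
    (hv : ∑ i, v i = 0) : ∑ i, ∑ j, ‖u i - u j‖ * v i * v j ≤ 0 := by
  borelize E
  have hint : ∀ i j, Integrable (fun θ => |inner ℝ (u i - u j) θ| * v i * v j) (stdGaussian E) :=
    fun i j => ((integrable_abs_inner_stdGaussian _).mul_const _).mul_const _
  have key : (∑ i, ∑ j, ‖u i - u j‖ * v i * v j) * ∫ t, |t| ∂gaussianReal 0 1 =
      ∫ θ, ∑ i, ∑ j, |inner ℝ (u i - u j) θ| * v i * v j ∂stdGaussian E := by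
    rw [integral_finsetSum _ fun i _ => integrable_finsetSum _ fun j _ => hint i j,
      Finset.sum_mul]
    refine Finset.sum_congr rfl fun i _ => ?_
    rw [integral_finsetSum _ fun j _ => hint i j, Finset.sum_mul]
    refine Finset.sum_congr rfl fun j _ => ?_
    rw [integral_mul_const, integral_mul_const, integral_abs_inner_stdGaussian]
    ring
  refine nonpos_of_mul_nonpos_left ?_ integral_abs_gaussianReal_pos
  rw [key]
  refine integral_nonpos fun θ => ?_
  simp only [inner_sub_left]
  exact sum_abs_sub_mul_mul_nonpos (fun i => inner ℝ (u i) θ) v hv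

theorem stmt_9 (n d : ℕ) (hn : 1 ≤ n) (hd : 1 ≤ d)
    (u : Fin n → EuclideanSpace ℝ (Fin d))
    (D : Matrix (Fin n) (Fin n) ℝ)
    (hD : ∀ i j, D i j = ‖u i - u j‖) :
    ∀ v : Fin n → ℝ, ∑ i, v i = 0 →
      ∑ i, ∑ j, D i j * v i * v j ≤ 0 := by
  intro v hv
  simpa only [hD] using sum_norm_sub_mul_mul_nonpos u v hv
end

section
/- Let n, d ≥ 1, let u_1, …, u_n be pairwise distinct points in the Euclidean space ℝ^d, and let k > 0 be a real number. Then the n×n matrix W with entries W_ij = exp(−k·‖u_i − u_j‖) is positive definite: for every nonzero v : Fin n → ℝ one has Σ_{i,j} W_ij · v_i · v_j > 0. -/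
open MeasureTheory Set Filter Topology ProbabilityTheory

section Subordination

theorem integrable_exp_neg_sq : Integrable (fun x : ℝ ↦ Real.exp (-x ^ 2)) := by
  simpa using integrable_exp_neg_mul_sq (b := 1) one_pos

theorem integral_Ioi_exp_neg_sq :
    ∫ x in Ioi (0 : ℝ), Real.exp (-x ^ 2) = √Real.pi / 2 := by
  simpa using integral_gaussian_Ioi 1

theorem integral_Iic_exp_neg_sq :
    ∫ x in Iic (0 : ℝ), Real.exp (-x ^ 2) = √Real.pi / 2 := by
  have h := integral_comp_neg_Ioi 0 (fun x : ℝ ↦ Real.exp (-x ^ 2))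
  simp only [neg_sq, neg_zero] at h
  rw [← h, integral_Ioi_exp_neg_sq]

theorem tendsto_integral_exp_neg_sq_atTop :
    Tendsto (fun y : ℝ ↦ ∫ t in (0 : ℝ)..y, Real.exp (-t ^ 2)) atTop (𝓝 (√Real.pi / 2)) := by
  rw [← integral_Ioi_exp_neg_sq]
  exact intervalIntegral_tendsto_integral_Ioi 0 integrable_exp_neg_sq.integrableOn tendsto_id

theorem tendsto_integral_exp_neg_sq_atBot :
    Tendsto (fun y : ℝ ↦ ∫ t in (0 : ℝ)..y, Real.exp (-t ^ 2)) atBot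
      (𝓝 (-(√Real.pi / 2))) := by
  rw [← integral_Iic_exp_neg_sq]
  simpa only [intervalIntegral.integral_symm _ (0 : ℝ), id] using
    (intervalIntegral_tendsto_integral_Iic 0 integrable_exp_neg_sq.integrableOn tendsto_id).neg

theorem hasDerivAt_integral_exp_neg_sq (y : ℝ) :
    HasDerivAt (fun y : ℝ ↦ ∫ t in (0 : ℝ)..y, Real.exp (-t ^ 2)) (Real.exp (-y ^ 2)) y :=
  (by fun_prop : Continuous fun t : ℝ ↦ Real.exp (-t ^ 2)).integral_hasStrictDerivAt 0 y
    |>.hasDerivAt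

theorem integrableOn_exp_neg_sq_add_div_sq (a : ℝ) :
    IntegrableOn (fun x : ℝ ↦ Real.exp (-(x ^ 2 + (a / x) ^ 2))) (Ioi 0) := by
  refine (integrable_exp_neg_sq.mono' (by measurability) (ae_of_all _ fun x ↦ ?_)).integrableOn
  rw [Real.norm_eq_abs, Real.abs_exp]
  gcongr
  linarith [sq_nonneg (a / x)]

/-- The subordination formula writing `exp (-2a)` as a mixture of the Gaussians in `a`. -/
theorem integral_Ioi_exp_neg_sq_add_div_sq {a : ℝ} (ha : 0 ≤ a) :
    ∫ x in Ioi (0 : ℝ), Real.exp (-(x ^ 2 + (a / x) ^ 2)) =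
      √Real.pi / 2 * Real.exp (-(2 * a)) := by
  rcases ha.eq_or_lt with rfl | ha
  · simp [integral_Ioi_exp_neg_sq]
  set P : ℝ → ℝ := fun y ↦ ∫ t in (0 : ℝ)..y, Real.exp (-t ^ 2)
  set G : ℝ → ℝ := fun x ↦
    (Real.exp (2 * a) * P (x + a / x) + Real.exp (-(2 * a)) * P (x - a / x)) / 2
  have hG (x : ℝ) (hx : 0 < x) : HasDerivAt G (Real.exp (-(x ^ 2 + (a / x) ^ 2))) x := by
    have hdiv : HasDerivAt (fun x ↦ a / x) (-(a / x ^ 2)) x := by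
      simpa [div_eq_mul_inv] using (hasDerivAt_inv hx.ne').const_mul a
    have hp := (hasDerivAt_integral_exp_neg_sq (x + a / x)).comp x ((hasDerivAt_id x).add hdiv)
    have hm := (hasDerivAt_integral_exp_neg_sq (x - a / x)).comp x ((hasDerivAt_id x).sub hdiv)
    have ep : Real.exp (-(x + a / x) ^ 2) =
        Real.exp (-(2 * a)) * Real.exp (-(x ^ 2 + (a / x) ^ 2)) := by
      rw [← Real.exp_add]; congr 1; field_simp; ring
    have em : Real.exp (-(x - a / x) ^ 2) =
        Real.exp (2 * a) * Real.exp (-(x ^ 2 + (a / x) ^ 2)) := by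
      rw [← Real.exp_add]; congr 1; field_simp; ring
    have e1 : Real.exp (2 * a) * Real.exp (-(2 * a)) = 1 := by
      rw [← Real.exp_add]; simp
    refine (((hp.const_mul (Real.exp (2 * a))).add
      (hm.const_mul (Real.exp (-(2 * a))))).div_const 2).congr_deriv ?_
    rw [ep, em]
    linear_combination Real.exp (-(x ^ 2 + (a / x) ^ 2)) * e1
  have hdiv0 : Tendsto (fun x : ℝ ↦ a / x) (𝓝[>] 0) atTop := by
    simpa [div_eq_mul_inv] using tendsto_inv_nhdsGT_zero.const_mul_atTop ha
  have hid0 : Tendsto (fun x : ℝ ↦ x) (𝓝[>] 0) (𝓝 0) := nhdsWithin_le_nhds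
  have hdivtop : Tendsto (fun x : ℝ ↦ a / x) atTop (𝓝 0) := tendsto_const_nhds.div_atTop tendsto_id
  have hG0 : Tendsto G (𝓝[>] 0)
      (𝓝 ((Real.exp (2 * a) * (√Real.pi / 2) + Real.exp (-(2 * a)) * (-(√Real.pi / 2))) / 2)) := by
    refine (((tendsto_integral_exp_neg_sq_atTop.comp (hid0.add_atTop hdiv0)).const_mul _).add
      ((tendsto_integral_exp_neg_sq_atBot.comp ?_).const_mul _)).div_const 2
    simpa [sub_eq_add_neg] using hid0.add_atBot (tendsto_neg_atTop_atBot.comp hdiv0)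
  have hGtop : Tendsto G atTop
      (𝓝 ((Real.exp (2 * a) * (√Real.pi / 2) + Real.exp (-(2 * a)) * (√Real.pi / 2)) / 2)) := by
    refine (((tendsto_integral_exp_neg_sq_atTop.comp
      (tendsto_id.atTop_add hdivtop)).const_mul _).add
      ((tendsto_integral_exp_neg_sq_atTop.comp ?_).const_mul _)).div_const 2
    simpa [sub_eq_add_neg] using tendsto_id.atTop_add hdivtop.neg
  set G' := Function.update G 0
    ((Real.exp (2 * a) * (√Real.pi / 2) + Real.exp (-(2 * a)) * (-(√Real.pi / 2))) / 2)
  have hGG' (x : ℝ) (hx : 0 < x) : G' =ᶠ[𝓝 x] G := by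
    filter_upwards [lt_mem_nhds hx] with y hy
    exact Function.update_of_ne hy.ne' _ _
  rw [integral_Ioi_of_hasDerivAt_of_tendsto (f := G') (a := 0)
    (by rwa [continuousWithinAt_update_same, Ici_sdiff_left])
    (fun x hx ↦ (hG x hx).congr_of_eventuallyEq (hGG' x hx))
    (integrableOn_exp_neg_sq_add_div_sq a)
    (hGtop.congr' ((eventually_gt_atTop 0).mono fun x hx ↦ ((hGG' x hx).self_of_nhds).symm))]
  simp only [G', Function.update_self]
  ring

end Subordination

section GaussianKernel

variable {E ι : Type*} [NormedAddCommGroup E] [Fintype ι]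

theorem integral_cos_inner_stdGaussian [InnerProductSpace ℝ E] [FiniteDimensional ℝ E]
    [MeasurableSpace E] [BorelSpace E] (t : E) :
    ∫ x, Real.cos (inner ℝ x t) ∂(stdGaussian E) = Real.exp (-‖t‖ ^ 2 / 2) := by
  have hint : Integrable (fun x : E ↦ Complex.exp (inner ℝ x t * Complex.I)) (stdGaussian E) := by
    refine (integrable_const (1 : ℝ)).mono' (by fun_prop) (ae_of_all _ fun x ↦ ?_)
    rw [Complex.norm_exp_ofReal_mul_I]
  have h := congrArg Complex.re (charFun_stdGaussian t)
  rw [charFun_apply] at h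
  have h2 := integral_re hint
  simp only [RCLike.re_to_complex, Complex.exp_ofReal_mul_I_re] at h2
  rw [h2, h]
  norm_cast

/-- The Gaussian kernel is positive semidefinite. -/
theorem sum_exp_neg_sq_norm_sub_nonneg [InnerProductSpace ℝ E] [FiniteDimensional ℝ E]
    (u : ι → E) (v : ι → ℝ) (b : ℝ) :
    0 ≤ ∑ i, ∑ j, Real.exp (-(b * ‖u i - u j‖) ^ 2) * v i * v j := by
  borelize E
  have hint (t : E) : Integrable (fun x : E ↦ Real.cos (inner ℝ x t)) (stdGaussian E) :=
    (integrable_const (1 : ℝ)).mono' (by fun_prop) (ae_of_all _ fun x ↦ Real.abs_cos_le_one _)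
  have key (i j : ι) : Real.exp (-(b * ‖u i - u j‖) ^ 2) =
      ∫ x, Real.cos (inner ℝ x ((√2 * b) • (u i - u j))) ∂(stdGaussian E) := by
    rw [integral_cos_inner_stdGaussian, norm_smul, mul_pow, mul_pow, Real.norm_eq_abs, sq_abs,
      mul_pow, Real.sq_sqrt zero_le_two]
    congr 1; ring
  simp_rw [key, ← integral_mul_const]
  have hint' (i j : ι) := ((hint ((√2 * b) • (u i - u j))).mul_const (v i)).mul_const (v j)
  simp_rw [← integral_finsetSum _ fun j _ ↦ hint' _ j]
  rw [← integral_finsetSum _ fun i _ ↦ integrable_finsetSum _ fun j _ ↦ hint' i j]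
  refine integral_nonneg fun x ↦ ?_
  have : ∑ i, ∑ j, Real.cos (inner ℝ x ((√2 * b) • (u i - u j))) * v i * v j =
      (∑ i, Real.cos (inner ℝ x ((√2 * b) • u i)) * v i) ^ 2 +
        (∑ i, Real.sin (inner ℝ x ((√2 * b) • u i)) * v i) ^ 2 := by
    simp_rw [sq, Finset.sum_mul_sum, ← Finset.sum_add_distrib, smul_sub, inner_sub_right,
      Real.cos_sub]
    exact Finset.sum_congr rfl fun i _ ↦ Finset.sum_congr rfl fun j _ ↦ by ring
  rw [this]
  positivity

/-- As the width of the Gaussian kernel shrinks, its matrix tends to the identity. -/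
theorem tendsto_sum_exp_neg_sq_norm_sub {u : ι → E} (hu : Function.Injective u) (v : ι → ℝ) :
    Tendsto (fun b : ℝ ↦ ∑ i, ∑ j, Real.exp (-(b * ‖u i - u j‖) ^ 2) * v i * v j) atTop
      (𝓝 (∑ i, v i ^ 2)) := by
  classical
  have : ∑ i, v i ^ 2 = ∑ i, ∑ j, (if i = j then 1 else 0) * v i * v j := by
    simp [ite_mul, sq]
  rw [this]
  refine tendsto_finsetSum _ fun i _ ↦ tendsto_finsetSum _ fun j _ ↦
    (Tendsto.mul_const _ ?_).mul_const _
  split_ifs with h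
  · simp [h]
  · have hr : 0 < ‖u i - u j‖ := norm_pos_iff.2 (sub_ne_zero.2 (hu.ne h))
    exact Real.tendsto_exp_neg_atTop_nhds_zero.comp
      ((tendsto_pow_atTop two_ne_zero).comp (tendsto_id.atTop_mul_const hr))

end GaussianKernel

theorem stmt_10 (n d : ℕ) (hn : 1 ≤ n) (hd : 1 ≤ d)
    (u : Fin n → EuclideanSpace ℝ (Fin d))
    (hu : Function.Injective u)
    (k : ℝ) (hk : 0 < k) :
    ∀ v : Fin n → ℝ, v ≠ 0 →
      0 < ∑ i, ∑ j, Real.exp (-k * ‖u i - u j‖) * v i * v j := by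
  intro v hv
  have hsq : 0 < ∑ i, v i ^ 2 := by
    obtain ⟨i, hi⟩ := Function.ne_iff.1 hv
    exact Finset.sum_pos' (fun _ _ ↦ sq_nonneg _) ⟨i, Finset.mem_univ i, sq_pos_of_ne_zero hi⟩
  obtain ⟨B, hB⟩ := eventually_atTop.1
    ((tendsto_sum_exp_neg_sq_norm_sub hu v).eventually (lt_mem_nhds hsq))
  set f : Fin n → Fin n → ℝ → ℝ := fun i j x ↦
    Real.exp (-(x ^ 2 + (k * ‖u i - u j‖ / 2 / x) ^ 2)) * v i * v j
  have hf (i j) : IntegrableOn (f i j) (Ioi 0) :=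
    ((integrableOn_exp_neg_sq_add_div_sq _).mul_const _).mul_const _
  have hsum (x : ℝ) : ∑ i, ∑ j, f i j x = Real.exp (-x ^ 2) *
      ∑ i, ∑ j, Real.exp (-(k / (2 * x) * ‖u i - u j‖) ^ 2) * v i * v j := by
    simp_rw [f, Finset.mul_sum, ← mul_assoc, ← Real.exp_add]
    refine Finset.sum_congr rfl fun i _ ↦ Finset.sum_congr rfl fun j _ ↦ ?_
    congr 3
    ring
  have hint : ∫ x in Ioi (0 : ℝ), ∑ i, ∑ j, f i j x =
      √Real.pi / 2 * ∑ i, ∑ j, Real.exp (-k * ‖u i - u j‖) * v i * v j := by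
    rw [integral_finsetSum _ fun i _ ↦ integrable_finsetSum _ fun j _ ↦ hf i j, Finset.mul_sum]
    refine Finset.sum_congr rfl fun i _ ↦ ?_
    rw [integral_finsetSum _ fun j _ ↦ hf i j, Finset.mul_sum]
    refine Finset.sum_congr rfl fun j _ ↦ ?_
    rw [integral_mul_const, integral_mul_const,
      integral_Ioi_exp_neg_sq_add_div_sq (by positivity)]
    ring_nf
  refine pos_of_mul_pos_right (a := √Real.pi / 2) ?_ (by positivity)
  rw [← hint, setIntegral_pos_iff_support_of_nonneg_ae]
  · set C := max B 1
    have hC : 0 < C := lt_max_of_lt_right one_pos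
    refine lt_of_lt_of_le ?_ (measure_mono (s := Ioo 0 (k / (2 * C))) fun x hx ↦ ⟨?_, hx.1⟩)
    · simpa using (by positivity : 0 < k / (2 * C))
    · have hx2 : B ≤ k / (2 * x) := by
        refine (le_max_left B 1).trans ?_
        have := (lt_div_iff₀ (by positivity)).1 hx.2
        rw [le_div_iff₀ (mul_pos two_pos hx.1)]
        linarith
      rw [Function.mem_support, hsum]
      exact (mul_pos (Real.exp_pos _) (hB _ hx2)).ne'
  · refine ae_of_all _ fun x ↦ ?_
    simp only [Pi.zero_apply, hsum]
    exact mul_nonneg (Real.exp_pos _).le (sum_exp_neg_sq_norm_sub_nonneg u v _)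
  · exact integrable_finsetSum _ fun i _ ↦ integrable_finsetSum _ fun j _ ↦ hf i j
end

section
/- Let G be a connected simple graph on the vertex set Fin n with n ≥ 1, and let L be its Laplacian matrix. Suppose Ω : Fin n → Fin n → ℝ satisfies: for all vertices i, j there exists f : Fin n → ℝ with L·f = e_i − e_j (where e_i is the i-th standard basis vector) and Ω i j = f i − f j. Then the effective resistance matrix Ω is of negative type: for every v : Fin n → ℝ with Σ_i v_i = 0 one has Σ_{i,j} Ω_ij · v_i · v_j ≤ 0. -/
open Matrix in
/-- A squared-distance matrix of vectors for a positive semidefinite form is of negative type. -/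
theorem sum_sum_dotProduct_mulVec_sub_nonpos {ι κ : Type*} [Fintype ι] [Fintype κ]
    {A : Matrix κ κ ℝ} (hA : A.PosSemidef) (g : ι → κ → ℝ) (v : ι → ℝ) (hv : ∑ i, v i = 0) :
    ∑ i, ∑ j, ((g i - g j) ⬝ᵥ (A *ᵥ (g i - g j))) * v i * v j ≤ 0 := by
  have hnonneg : 0 ≤ ∑ i, ∑ j, (g i ⬝ᵥ (A *ᵥ g j)) * v i * v j := by
    have h := hA.dotProduct_mulVec_nonneg (∑ i, v i • g i)
    rw [star_trivial, mulVec_sum, sum_dotProduct] at h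
    refine h.trans_eq (Finset.sum_congr rfl fun i _ => ?_)
    rw [dotProduct_sum]
    refine Finset.sum_congr rfl fun j _ => ?_
    simp only [mulVec_smul, dotProduct_smul, smul_dotProduct, smul_eq_mul]
    ring
  have hexpand : ∑ i, ∑ j, ((g i - g j) ⬝ᵥ (A *ᵥ (g i - g j))) * v i * v j =
      (∑ i, (g i ⬝ᵥ (A *ᵥ g i)) * v i) * ∑ j, v j +
      (∑ i, v i) * ∑ j, (g j ⬝ᵥ (A *ᵥ g j)) * v j -
      ∑ i, ∑ j, (g i ⬝ᵥ (A *ᵥ g j)) * v i * v j -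
      ∑ i, ∑ j, (g j ⬝ᵥ (A *ᵥ g i)) * v j * v i := by
    simp only [Finset.sum_mul_sum, ← Finset.sum_add_distrib, ← Finset.sum_sub_distrib]
    refine Finset.sum_congr rfl fun i _ => Finset.sum_congr rfl fun j _ => ?_
    simp only [mulVec_sub, dotProduct_sub, sub_dotProduct]
    ring
  rw [hexpand, hv, Finset.sum_comm (f := fun i j => (g j ⬝ᵥ (A *ᵥ g i)) * v j * v i)]
  linarith

theorem stmt_11 (n : ℕ) (hn : 1 ≤ n) (G : SimpleGraph (Fin n))
    [DecidableRel G.Adj] (hconn : G.Connected)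
    (Ω : Fin n → Fin n → ℝ)
    (hΩ : ∀ i j : Fin n, ∃ f : Fin n → ℝ,
      (G.lapMatrix ℝ).mulVec f = Pi.single i 1 - Pi.single j 1 ∧
        Ω i j = f i - f j) :
    ∀ v : Fin n → ℝ, ∑ i, v i = 0 →
      ∑ i, ∑ j, Ω i j * v i * v j ≤ 0 := by
  intro v hv
  choose f hf hΩf using hΩ
  let g : Fin n → Fin n → ℝ := fun i => f i ⟨0, hn⟩
  have hg (i j : Fin n) :
      (G.lapMatrix ℝ).mulVec (g i - g j) = Pi.single i 1 - Pi.single j 1 := by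
    simp [g, Matrix.mulVec_sub, hf]
  have hΩg (i j : Fin n) :
      Ω i j = (g i - g j) ⬝ᵥ (G.lapMatrix ℝ).mulVec (g i - g j) := by
    have h₁ : Ω i j = f i j ⬝ᵥ (G.lapMatrix ℝ).mulVec (g i - g j) := by
      rw [hg, hΩf]
      simp [dotProduct_sub]
    rw [h₁, Matrix.dotProduct_mulVec, ← Matrix.mulVec_transpose, (G.isSymm_lapMatrix (R := ℝ)).eq,
      hf, ← hg, dotProduct_comm]
  simp only [hΩg]
  exact sum_sum_dotProduct_mulVec_sub_nonpos (G.posSemidef_lapMatrix ℝ) g v hv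
end

section
/- Let G be a connected simple graph on the vertex set Fin n with n ≥ 1, let L be its Laplacian matrix, and let Ω : Fin n → Fin n → ℝ be its effective resistance matrix (so for all i, j there exists f with L·f = e_i − e_j and Ω i j = f i − f j). Then for every real k > 0, the matrix W with entries W_ij = exp(−k·Ω_ij) is positive definite: for every nonzero v : Fin n → ℝ one has Σ_{i,j} W_ij · v_i · v_j > 0. -/
namespace Matrix

variable {ι : Type*} [Fintype ι]

theorem PosSemidef.map_pow_s12 {C : Matrix ι ι ℝ} (hC : C.PosSemidef) (m : ℕ) :
    (C.map (· ^ m)).PosSemidef := by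
  induction m with
  | zero =>
    convert posSemidef_vecMulVec_self_star (fun _ : ι => (1 : ℝ)) using 1
    ext i j
    simp [vecMulVec_apply]
  | succ m ih =>
    have : C.map (· ^ (m + 1)) = C.map (· ^ m) ⊙ C := by
      ext i j
      simp [pow_succ]
    rw [this]
    exact ih.hadamard hC

/-- The entrywise exponential of a positive semidefinite matrix `C` dominates `J + C`, where `J`
is the all-ones matrix. -/
theorem PosSemidef.sq_sum_add_le_sum_exp {C : Matrix ι ι ℝ} (hC : C.PosSemidef) (v : ι → ℝ) :
    (∑ i, v i) ^ 2 + v ⬝ᵥ C *ᵥ v ≤ ∑ i, ∑ j, Real.exp (C i j) * v i * v j := by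
  have hsum : HasSum (fun m : ℕ => ∑ i, ∑ j, (C i j ^ m / m.factorial) * v i * v j)
      (∑ i, ∑ j, Real.exp (C i j) * v i * v j) := by
    refine hasSum_sum fun i _ => hasSum_sum fun j _ => ?_
    have h := NormedSpace.expSeries_div_hasSum_exp (C i j)
    rw [← Real.exp_eq_exp_ℝ] at h
    exact (h.mul_right _).mul_right _
  have hnonneg (m : ℕ) : 0 ≤ ∑ i, ∑ j, (C i j ^ m / m.factorial) * v i * v j := by
    have h := (hC.map_pow_s12 m).dotProduct_mulVec_nonneg v
    refine (div_nonneg h (Nat.cast_nonneg (α := ℝ) m.factorial)).trans_eq ?_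
    simp only [dotProduct, mulVec, Finset.mul_sum, Finset.sum_div]
    refine Finset.sum_congr rfl fun i _ => Finset.sum_congr rfl fun j _ => ?_
    simp only [star_trivial, map_apply]
    ring
  refine le_trans (le_of_eq ?_) (sum_le_hasSum (Finset.range 2) (fun m _ => hnonneg m) hsum)
  rw [Finset.sum_range_succ, Finset.sum_range_one, sq, Finset.sum_mul_sum]
  simp only [dotProduct, mulVec, Finset.mul_sum]
  congr 1 <;> refine Finset.sum_congr rfl fun i _ => Finset.sum_congr rfl fun j _ => ?_
  · simp
  · simp only [pow_one, Nat.factorial_one, Nat.cast_one]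
    ring

end Matrix

open Matrix in
theorem SimpleGraph.Connected.sub_eq_sub_of_lapMatrix_mulVec_eq {V : Type*} [Fintype V]
    [DecidableEq V] {G : SimpleGraph V} [DecidableRel G.Adj] (hconn : G.Connected) {f g : V → ℝ}
    (h : G.lapMatrix ℝ *ᵥ f = G.lapMatrix ℝ *ᵥ g) (i j : V) : f i - f j = g i - g j := by
  have h0 : G.lapMatrix ℝ *ᵥ (f - g) = 0 := by rw [mulVec_sub, h, sub_self]
  have := (G.lapMatrix_mulVec_eq_zero_iff_forall_reachable).1 h0 i j (hconn.preconnected i j)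
  simp only [Pi.sub_apply] at this
  linarith

theorem stmt_12 (n : ℕ) (hn : 1 ≤ n) (G : SimpleGraph (Fin n))
    [DecidableRel G.Adj] (hconn : G.Connected)
    (Ω : Fin n → Fin n → ℝ)
    (hΩ : ∀ i j : Fin n, ∃ f : Fin n → ℝ,
      (G.lapMatrix ℝ).mulVec f = Pi.single i 1 - Pi.single j 1 ∧
        Ω i j = f i - f j)
    (k : ℝ) (hk : 0 < k) :
    ∀ v : Fin n → ℝ, v ≠ 0 →
      0 < ∑ i, ∑ j, Real.exp (-k * Ω i j) * v i * v j := by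
  open Matrix in
  intro v hv
  let r : Fin n := ⟨0, hn⟩
  choose f hf _ using fun i => hΩ i r
  let F : Matrix (Fin n) (Fin n) ℝ := (of f)ᵀ
  set L := G.lapMatrix ℝ with hL
  have hLpos : L.PosSemidef := G.posSemidef_lapMatrix ℝ
  let B : Matrix (Fin n) (Fin n) ℝ := Fᴴ * L * F
  have hB : B.PosSemidef := hLpos.conjTranspose_mul_mul_same F
  have hLF (w : Fin n → ℝ) : L *ᵥ (F *ᵥ w) = w - Pi.single r (∑ i, w i) := by
    have hFw : F *ᵥ w = ∑ i, w i • f i := by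
      ext x
      simp [F, mulVec, dotProduct, mul_comm]
    ext x
    simp [hFw, mulVec_sum, mulVec_smul, hf, mul_sub, Finset.sum_sub_distrib, Pi.single_apply]
  have hBapply (i j : Fin n) : B i j = f i j - f i r := by
    have : B i j = f i ⬝ᵥ L *ᵥ f j := by
      simp only [B, Matrix.mul_assoc]
      rfl
    rw [this, hf, dotProduct_sub]
    simp
  have hBsymm (i j : Fin n) : B i j = B j i := by simpa using hB.isHermitian.apply j i
  have hΩB (i j : Fin n) : Ω i j = B i i + B j j - 2 * B i j := by
    obtain ⟨h, hh, hij⟩ := hΩ i j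
    have := hconn.sub_eq_sub_of_lapMatrix_mulVec_eq (f := h) (g := f i - f j)
      (by rw [← hL, hh, mulVec_sub, hf, hf]; abel) i j
    have hs := hBsymm i j
    simp only [hBapply, Pi.sub_apply] at *
    linarith
  let u : Fin n → ℝ := fun i => Real.exp (-k * B i i) * v i
  have hu : u ≠ 0 := fun h => hv <| funext fun i => by
    simpa [u, (Real.exp_pos _).ne'] using congrFun h i
  have hC : ((2 * k) • B).PosSemidef := hB.smul (by positivity)
  have hsum : ∑ i, ∑ j, Real.exp (-k * Ω i j) * v i * v j =
      ∑ i, ∑ j, Real.exp (((2 * k) • B) i j) * u i * u j := by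
    refine Finset.sum_congr rfl fun i _ => Finset.sum_congr rfl fun j _ => ?_
    have : -k * Ω i j = (2 * k) * B i j + -k * B i i + -k * B j j := by rw [hΩB]; ring
    rw [this, Real.exp_add, Real.exp_add]
    simp only [u, Matrix.smul_apply, smul_eq_mul]
    ring
  rw [hsum]
  refine lt_of_lt_of_le ?_ (hC.sq_sum_add_le_sum_exp u)
  have hCu : 0 ≤ u ⬝ᵥ ((2 * k) • B) *ᵥ u := by simpa using hC.dotProduct_mulVec_nonneg u
  refine lt_of_le_of_ne (by positivity) fun h0 => hu ?_
  have hs : ∑ i, u i = 0 := pow_eq_zero_iff two_ne_zero |>.1 (by nlinarith [sq_nonneg (∑ i, u i)])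
  have hBu : u ⬝ᵥ B *ᵥ u = 0 := by
    have : u ⬝ᵥ ((2 * k) • B) *ᵥ u = 0 := by simpa [hs] using h0.symm
    simpa [smul_mulVec, hk.ne'] using this
  have hLFu : L *ᵥ (F *ᵥ u) = 0 := by
    rw [← hLpos.dotProduct_mulVec_zero_iff, ← hBu]
    simp [B, ← mulVec_mulVec, dotProduct_mulVec, vecMul_transpose]
  simpa [hs] using (hLF u).symm.trans hLFu
end

section
/- Let P be the 5×5 shortest-path distance matrix of the complete bipartite graph K_{2,3} with parts {1,2} and {3,4,5}, i.e., P_ii = 0, P_12 = P_21 = 2, P_ij = 2 for distinct i, j both in {3,4,5}, and P_ij = 1 whenever i and j lie in different parts. Let W be the matrix with entries W_ij = exp(−P_ij/4). Then W is not positive definite on span(1)^⊥: for the vector v = (3, 3, −2, −2, −2), which satisfies Σ_i v_i = 0, one has Σ_{i,j} W_ij · v_i · v_j = 30 + 42·exp(−1/2) − 72·exp(−1/4) < 0. -/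
theorem stmt_13 (P : Matrix (Fin 5) (Fin 5) ℝ)
    (hP : P = !![0, 2, 1, 1, 1;
                 2, 0, 1, 1, 1;
                 1, 1, 0, 2, 2;
                 1, 1, 2, 0, 2;
                 1, 1, 2, 2, 0])
    (W : Matrix (Fin 5) (Fin 5) ℝ)
    (hW : ∀ i j, W i j = Real.exp (-(P i j) / 4))
    (v : Fin 5 → ℝ) (hv : v = ![3, 3, -2, -2, -2]) :
    (∑ i, v i = 0) ∧
    (∑ i, ∑ j, W i j * v i * v j =
      30 + 42 * Real.exp (-(1 / 2 : ℝ)) - 72 * Real.exp (-(1 / 4 : ℝ))) ∧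
    (30 + 42 * Real.exp (-(1 / 2 : ℝ)) - 72 * Real.exp (-(1 / 4 : ℝ)) < 0) := by
  have hsq : Real.exp (-(1 / 2 : ℝ)) = Real.exp (-(1 / 4 : ℝ)) ^ 2 := by
    rw [← Real.exp_nat_mul]
    norm_num
  refine ⟨?_, ?_, ?_⟩
  · subst hv
    norm_num [Fin.sum_univ_succ]
  · have h0 : Real.exp (-0 / 4) = 1 := by norm_num
    have h1 : Real.exp (-1 / 4) = Real.exp (-(1 / 4 : ℝ)) := by norm_num
    have h2 : Real.exp (-2 / 4) = Real.exp (-(1 / 2 : ℝ)) := by norm_num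
    subst hP hv
    simp only [hW, Fin.sum_univ_five, Matrix.of_apply, Matrix.cons_val, h0, h1, h2]
    ring
  · -- The expression factors as `6 (7x - 5) (x - 1)` with `x = exp (-1/4)` in `[3/4, 1)`.
    have hlt : Real.exp (-(1 / 4 : ℝ)) < 1 := Real.exp_lt_one_iff.mpr (by norm_num)
    have hge := Real.add_one_le_exp (-(1 / 4 : ℝ))
    rw [hsq]
    nlinarith
end

section
/- (Schoenberg embedding) Let n ≥ 1 and let D be a real symmetric n×n matrix with zero diagonal, nonnegative entries, and of negative type. Then there exist points u_1, …, u_n in the Euclidean space ℝ^n such that D_ij = ‖u_i − u_j‖² for all i, j. -/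
/-- The candidate Gram matrix of a matrix of squared distances, taking the point indexed by `o`
as the origin. -/
noncomputable def gramOfSqDist {ι : Type*} (D : Matrix ι ι ℝ) (o : ι) : Matrix ι ι ℝ :=
  Matrix.of fun i j => (D i o + D j o - D i j) / 2

theorem gramOfSqDist_posSemidef {ι : Type*} [Fintype ι] (D : Matrix ι ι ℝ) (o : ι)
    (hsymm : D.IsSymm) (hdiag : D o o = 0)
    (hneg : ∀ v : ι → ℝ, ∑ i, v i = 0 → ∑ i, ∑ j, D i j * v i * v j ≤ 0) :
    (gramOfSqDist D o).PosSemidef := by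
  classical
  refine .of_dotProduct_mulVec_nonneg ?_ fun x => ?_
  · ext i j
    simp only [gramOfSqDist, Matrix.conjTranspose_apply, Matrix.of_apply, star_trivial,
      hsymm.apply i j]
    ring
  · set S := ∑ i, x i with hS
    have hv := hneg (fun i => x i - if i = o then S else 0) (by simp [← hS])
    have hD : ∀ j, D o j = D j o := fun j => hsymm.apply j o
    have expand : ∑ i, ∑ j, D i j * (x i - if i = o then S else 0) * (x j - if j = o then S else 0)
        = ∑ i, ∑ j, D i j * x i * x j - 2 * S * ∑ i, D i o * x i := by
      simp only [mul_sub, sub_mul, Finset.sum_sub_distrib, mul_ite, ite_mul, mul_zero, zero_mul,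
        Finset.sum_ite_eq', Finset.mem_univ, if_true, Finset.sum_ite_irrel, Finset.sum_const_zero,
        hdiag, hD, ← Finset.sum_mul]
      simp only [mul_right_comm _ S, ← Finset.sum_mul]
      ring
    have gram : star x ⬝ᵥ (gramOfSqDist D o).mulVec x
        = S * ∑ i, D i o * x i - (∑ i, ∑ j, D i j * x i * x j) / 2 := by
      have h1 : S * ∑ i, D i o * x i = ∑ i, ∑ j, D i o * x i * x j := by
        rw [hS, mul_comm, Finset.sum_mul_sum]
      have h2 : S * ∑ i, D i o * x i = ∑ i, ∑ j, D j o * x i * x j := by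
        rw [hS, Finset.sum_mul_sum]
        exact Finset.sum_congr rfl fun i _ => Finset.sum_congr rfl fun j _ => by ring
      have h3 : S * ∑ i, D i o * x i = (∑ i, ∑ j, D i o * x i * x j
          + ∑ i, ∑ j, D j o * x i * x j) / 2 := by linarith
      rw [h3]
      simp only [dotProduct, Matrix.mulVec, gramOfSqDist, Matrix.of_apply, Pi.star_apply,
        star_trivial, ← Finset.sum_add_distrib, Finset.sum_div, ← Finset.sum_sub_distrib,
        Finset.mul_sum]
      exact Finset.sum_congr rfl fun i _ => Finset.sum_congr rfl fun j _ => by ring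
    linarith

theorem stmt_15 (n : ℕ) (hn : 1 ≤ n) (D : Matrix (Fin n) (Fin n) ℝ)
    (hsymm : D.IsSymm)
    (hdiag : ∀ i, D i i = 0)
    (hnonneg : ∀ i j, 0 ≤ D i j)
    (hneg : ∀ v : Fin n → ℝ, ∑ i, v i = 0 →
      ∑ i, ∑ j, D i j * v i * v j ≤ 0) :
    ∃ u : Fin n → EuclideanSpace ℝ (Fin n),
      ∀ i j, D i j = ‖u i - u j‖ ^ 2 := by
  let o : Fin n := ⟨0, hn⟩
  obtain ⟨B, hB⟩ : ∃ B : Matrix (Fin n) (Fin n) ℝ, gramOfSqDist D o = B.conjTranspose * B := by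
    open scoped MatrixOrder in
    exact CStarAlgebra.nonneg_iff_eq_star_mul_self.mp
      (gramOfSqDist_posSemidef D o hsymm (hdiag o) hneg).nonneg
  have entry : ∀ i j, (D i o + D j o - D i j) / 2 = ∑ k, B k i * B k j := fun i j => by
    simpa [gramOfSqDist, Matrix.mul_apply] using congrFun (congrFun hB i) j
  refine ⟨fun i => WithLp.toLp 2 fun k => B k i, fun i j => ?_⟩
  have norm_sq : ‖(WithLp.toLp 2 fun k => B k i : EuclideanSpace ℝ (Fin n))
      - WithLp.toLp 2 fun k => B k j‖ ^ 2
      = ∑ k, B k i * B k i - 2 * ∑ k, B k i * B k j + ∑ k, B k j * B k j := by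
    simp only [EuclideanSpace.real_norm_sq_eq, PiLp.sub_apply, Finset.mul_sum,
      ← Finset.sum_sub_distrib, ← Finset.sum_add_distrib]
    exact Finset.sum_congr rfl fun k _ => by ring
  rw [norm_sq, ← entry, ← entry, ← entry, hdiag, hdiag]
  ring
end
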